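/- arXiv:2112.13740 — 2 statements merged into one kernel-verified Lean document; each statement's English description precedes it below -/
import Mathlib

section
/- Discrete trace estimate for polynomials on lower-dimensional sets (Lemma 3.1, inequality (3.6), for α = 0, stated for an abstract cut element): for all integers d ≥ 1, m ≥ 0 and reals λ ≥ 1, c₀ ∈ (0, 1], C_S > 0, there exists a constant C > 0, depending only on d, m, λ, c₀ and C_S, such that the following holds. For every h > 0, every pair of points x₀, x₁ ∈ ℝ^d with dist(x₀, x₁) ≤ λ h, every Borel set S ⊆ closedBall(x₀, λ h) with μH^{d−1}(S) ≤ C_S · h^{d−1}, and every polynomial p of degree at most m in d variables, one has ∫_S p² dμH^{d−1} ≤ C · h^{−1} · ∫_{B(x₁, c₀ h)} p(x)² dx. -/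
open MeasureTheory Metric

/-- Substituting polynomials of total degree at most one does not increase the total degree. -/
theorem MvPolynomial.totalDegree_bind₁_le_of_le_one {σ τ R : Type*} [CommSemiring R]
    (f : σ → MvPolynomial τ R) (hf : ∀ i, (f i).totalDegree ≤ 1) (p : MvPolynomial σ R) :
    (MvPolynomial.bind₁ f p).totalDegree ≤ p.totalDegree := by
  rw [MvPolynomial.bind₁, MvPolynomial.aeval_def, MvPolynomial.eval₂_eq]
  refine MvPolynomial.totalDegree_finsetSum_le fun s hs => ?_
  refine (MvPolynomial.totalDegree_mul _ _).trans ?_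
  rw [MvPolynomial.algebraMap_eq, MvPolynomial.totalDegree_C, zero_add]
  refine (MvPolynomial.totalDegree_finsetProd _ _).trans
    (le_trans (Finset.sum_le_sum fun i _ => ?_) (MvPolynomial.le_totalDegree hs))
  exact (MvPolynomial.totalDegree_pow _ _).trans (mul_le_of_le_one_right' (hf i))

theorem MvPolynomial.continuous_eval_euclideanSpace {d : ℕ} (p : MvPolynomial (Fin d) ℝ) :
    Continuous fun x : EuclideanSpace ℝ (Fin d) => MvPolynomial.eval (fun i => x i) p :=
  (MvPolynomial.continuous_eval p).comp (by fun_prop)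

/-- A polynomial vanishing on the open unit ball is zero. -/
theorem MvPolynomial.eq_zero_of_eqOn_ball {d : ℕ} (p : MvPolynomial (Fin d) ℝ)
    (hp : ∀ x ∈ ball (0 : EuclideanSpace ℝ (Fin d)) 1, MvPolynomial.eval (fun i => x i) p = 0) :
    p = 0 := by
  have hopen : IsOpen ((WithLp.toLp 2 : (Fin d → ℝ) → EuclideanSpace ℝ (Fin d)) ⁻¹' ball 0 1) :=
    isOpen_ball.preimage (PiLp.continuous_toLp 2 _)
  obtain ⟨ε, hε, hsub⟩ := Metric.isOpen_iff.1 hopen 0 (by simp)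
  refine MvPolynomial.funext_set (fun _ : Fin d => ball (0 : ℝ) ε)
    (fun _ => infinite_of_mem_nhds 0 (ball_mem_nhds 0 hε)) fun x hx => ?_
  rw [map_zero]
  refine hp (WithLp.toLp 2 x) (hsub ?_)
  rw [ball_pi _ hε]
  exact hx

theorem MvPolynomial.memLp_two_ball {d : ℕ} (p : MvPolynomial (Fin d) ℝ) :
    MemLp (fun x : EuclideanSpace ℝ (Fin d) => MvPolynomial.eval (fun i => x i) p) 2
      (volume.restrict (ball 0 1)) := by
  have hc := p.continuous_eval_euclideanSpace
  rw [memLp_two_iff_integrable_sq hc.aestronglyMeasurable]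
  exact ((hc.pow 2).continuousOn.integrableOn_compact
    (isCompact_closedBall 0 1)).mono_set ball_subset_closedBall

/-- On polynomials of bounded degree, the sup norm over a ball is controlled by the `L²` norm
over the unit ball. -/
theorem MvPolynomial.exists_sq_eval_le_integral_ball (d m : ℕ) (R : ℝ) :
    ∃ C : ℝ, 0 < C ∧ ∀ p : MvPolynomial (Fin d) ℝ, p.totalDegree ≤ m →
      ∀ y ∈ closedBall (0 : EuclideanSpace ℝ (Fin d)) R,
        (MvPolynomial.eval (fun i => y i) p) ^ 2 ≤
          C * ∫ x in ball (0 : EuclideanSpace ℝ (Fin d)) 1,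
            (MvPolynomial.eval (fun i => x i) p) ^ 2 := by
  let E := EuclideanSpace ℝ (Fin d)
  let V := MvPolynomial.restrictTotalDegree (Fin d) ℝ m
  let L : V →ₗ[ℝ] Lp ℝ 2 (volume.restrict (ball (0 : E) 1)) :=
    { toFun := fun p => p.1.memLp_two_ball.toLp _
      map_add' := fun p q => by
        rw [← MemLp.toLp_add]
        congr 1
        ext x
        simp
      map_smul' := fun c p => by
        rw [RingHom.id_apply, ← MemLp.toLp_const_smul]
        congr 1
        ext x
        simp [MvPolynomial.smul_eval] }
  have hL : Function.Injective L := by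
    rw [injective_iff_map_eq_zero]
    intro p hp
    have hae : (fun x : E => MvPolynomial.eval (fun i => x i) p.1)
        =ᵐ[volume.restrict (ball 0 1)] 0 :=
      (MemLp.coeFn_toLp p.1.memLp_two_ball).symm.trans ((Lp.eq_zero_iff_ae_eq_zero).1 hp)
    exact Subtype.ext (p.1.eq_zero_of_eqOn_ball fun x hx =>
      Measure.eqOn_open_of_ae_eq hae isOpen_ball
        p.1.continuous_eval_euclideanSpace.continuousOn continuousOn_const hx)
  let T : V →ₗ[ℝ] C(closedBall (0 : E) R, ℝ) :=
    { toFun := fun p => ⟨fun x => MvPolynomial.eval (fun i => x.1 i) p.1,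
        p.1.continuous_eval_euclideanSpace.comp continuous_subtype_val⟩
      map_add' := fun p q => by ext x; simp
      map_smul' := fun c p => by ext x; simp [MvPolynomial.smul_eval] }
  let e := LinearEquiv.ofInjective L hL
  let G := LinearMap.toContinuousLinearMap (T ∘ₗ e.symm.toLinearMap)
  have hnorm (p : V) : ‖L p‖ ^ 2 =
      ∫ x in ball (0 : E) 1, (MvPolynomial.eval (fun i => x i) p.1) ^ 2 := by
    rw [← real_inner_self_eq_norm_sq, L2.inner_def]
    refine integral_congr_ae ?_
    filter_upwards [MemLp.coeFn_toLp p.1.memLp_two_ball] with x hx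
    change inner ℝ (MemLp.toLp _ p.1.memLp_two_ball x) (MemLp.toLp _ p.1.memLp_two_ball x) = _
    rw [hx, real_inner_self_eq_norm_sq, Real.norm_eq_abs, sq_abs]
  refine ⟨‖G‖ ^ 2 + 1, by positivity, fun p hp y hy => ?_⟩
  let q : V := ⟨p, (MvPolynomial.mem_restrictTotalDegree _ _ _).2 hp⟩
  have h1 : ‖T q‖ ≤ ‖G‖ * ‖L q‖ := by
    have := G.le_opNorm (e q)
    simpa [G, e] using this
  have h2 : |MvPolynomial.eval (fun i => y i) p| ≤ ‖G‖ * ‖L q‖ :=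
    ((T q).norm_coe_le_norm ⟨y, hy⟩).trans h1
  rw [← hnorm q, ← sq_abs]
  calc _ ≤ (‖G‖ * ‖L q‖) ^ 2 := by gcongr
    _ ≤ (‖G‖ ^ 2 + 1) * ‖L q‖ ^ 2 := by nlinarith [sq_nonneg ‖L q‖]

/-- The scaled form, on the ball of center `x₁` and radius `r`. -/
theorem MvPolynomial.exists_sq_eval_le_integral_ball_scaled (d m : ℕ) (R : ℝ) :
    ∃ C : ℝ, 0 < C ∧ ∀ p : MvPolynomial (Fin d) ℝ, p.totalDegree ≤ m →
      ∀ (x₁ : EuclideanSpace ℝ (Fin d)) (r : ℝ), 0 < r → ∀ y ∈ closedBall x₁ (R * r),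
        (MvPolynomial.eval (fun i => y i) p) ^ 2 ≤
          C * (r ^ d)⁻¹ * ∫ x in ball x₁ r, (MvPolynomial.eval (fun i => x i) p) ^ 2 := by
  obtain ⟨C, hC, H⟩ := MvPolynomial.exists_sq_eval_le_integral_ball d m R
  refine ⟨C, hC, fun p hp x₁ r hr y hy => ?_⟩
  let f : Fin d → MvPolynomial (Fin d) ℝ := fun i =>
    MvPolynomial.C (x₁ i) + MvPolynomial.C r * MvPolynomial.X i
  have hf (i : Fin d) : (f i).totalDegree ≤ 1 := by
    refine (MvPolynomial.totalDegree_add _ _).trans (max_le (by simp) ?_)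
    exact (MvPolynomial.totalDegree_mul _ _).trans (by simp)
  have heval (z : EuclideanSpace ℝ (Fin d)) :
      MvPolynomial.eval (fun i => z i) (MvPolynomial.bind₁ f p) =
        MvPolynomial.eval (fun i => (x₁ + r • z) i) p := by
    rw [MvPolynomial.eval, MvPolynomial.eval₂Hom_bind₁]
    simp [f]
  have hmem : r⁻¹ • (y - x₁) ∈ closedBall (0 : EuclideanSpace ℝ (Fin d)) R := by
    rw [mem_closedBall, dist_eq_norm] at hy
    rw [mem_closedBall_zero_iff, norm_smul, norm_inv, Real.norm_of_nonneg hr.le, ← div_eq_inv_mul,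
      div_le_iff₀ hr]
    exact hy
  have key := H _ ((MvPolynomial.totalDegree_bind₁_le_of_le_one f hf p).trans hp) _ hmem
  simp only [heval] at key
  rw [smul_inv_smul₀ hr.ne', add_sub_cancel] at key
  refine key.trans_eq ?_
  have hpre : (fun x => x₁ + x) ⁻¹' ball x₁ r = ball 0 r := by
    ext x; simp
  rw [Measure.setIntegral_comp_smul_of_pos volume
      (fun z => (MvPolynomial.eval (fun i => (x₁ + z) i) p) ^ 2) _ hr,
    smul_unitBall_of_pos hr, finrank_euclideanSpace_fin, smul_eq_mul, mul_assoc, ← hpre,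
    (measurePreserving_add_left volume x₁).setIntegral_preimage_emb
      (measurableEmbedding_addLeft x₁) (fun x => (MvPolynomial.eval (fun i => x i) p) ^ 2)]

/-- Discrete trace estimate for polynomials on lower-dimensional sets
(Lemma 3.1, inequality (3.6), α = 0, abstract form). -/
theorem polynomial_discrete_trace_estimate
    (d m : ℕ) (hd : 1 ≤ d) (lam c₀ CS : ℝ)
    (hlam : 1 ≤ lam) (hc₀ : 0 < c₀) (hc₀' : c₀ ≤ 1) (hCS : 0 < CS) :
    ∃ C : ℝ, 0 < C ∧
      ∀ (h : ℝ), 0 < h →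
        ∀ (x₀ x₁ : EuclideanSpace ℝ (Fin d)), dist x₀ x₁ ≤ lam * h →
          ∀ S : Set (EuclideanSpace ℝ (Fin d)), MeasurableSet S →
            S ⊆ closedBall x₀ (lam * h) →
            μH[(d : ℝ) - 1] S ≤ ENNReal.ofReal (CS * h ^ (d - 1)) →
            ∀ p : MvPolynomial (Fin d) ℝ, p.totalDegree ≤ m →
              ∫ x in S, (MvPolynomial.eval (fun i => x i) p) ^ 2
                  ∂(μH[(d : ℝ) - 1]) ≤
                C * h⁻¹ * ∫ x in ball x₁ (c₀ * h),
                  (MvPolynomial.eval (fun i => x i) p) ^ 2 := by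
  obtain ⟨C, hC, H⟩ := MvPolynomial.exists_sq_eval_le_integral_ball_scaled d m (2 * lam / c₀)
  refine ⟨C * (c₀ ^ d)⁻¹ * CS, by positivity, fun h hh x₀ x₁ hx S _ hS hμ p hp => ?_⟩
  set I := ∫ x in ball x₁ (c₀ * h), (MvPolynomial.eval (fun i => x i) p) ^ 2
  have hI : 0 ≤ I := integral_nonneg fun x => sq_nonneg _
  have hbound : ∀ y ∈ S, ‖(MvPolynomial.eval (fun i => y i) p) ^ 2‖ ≤
      C * ((c₀ * h) ^ d)⁻¹ * I := by
    intro y hy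
    rw [Real.norm_of_nonneg (sq_nonneg _)]
    refine H p hp x₁ (c₀ * h) (by positivity) y ?_
    have hy₀ : dist y x₀ ≤ lam * h := hS hy
    have hR : 2 * lam / c₀ * (c₀ * h) = lam * h + lam * h := by field_simp; ring
    rw [mem_closedBall, hR]
    exact (dist_triangle y x₀ x₁).trans (add_le_add hy₀ hx)
  have hreal : (μH[(d : ℝ) - 1]).real S ≤ CS * h ^ (d - 1) :=
    ENNReal.toReal_le_of_le_ofReal (by positivity) hμ
  calc _ ≤ C * ((c₀ * h) ^ d)⁻¹ * I * (μH[(d : ℝ) - 1]).real S :=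
        (Real.le_norm_self _).trans
          (norm_setIntegral_le_of_norm_le_const (hμ.trans_lt ENNReal.ofReal_lt_top) hbound)
    _ ≤ C * ((c₀ * h) ^ d)⁻¹ * I * (CS * h ^ (d - 1)) := by gcongr
    _ = C * (c₀ ^ d)⁻¹ * CS * h⁻¹ * I := by
        obtain ⟨n, rfl⟩ := Nat.exists_eq_add_of_le' hd
        rw [Nat.add_sub_cancel, mul_pow, pow_succ h]
        field_simp
end

section
/- Discrete trace estimate for gradients of polynomials on lower-dimensional sets (Lemma 3.1, inequality (3.6), for α = 1, stated for an abstract cut element): for all integers d ≥ 1, m ≥ 0 and reals λ ≥ 1, c₀ ∈ (0, 1], C_S > 0, there exists a constant C > 0, depending only on d, m, λ, c₀ and C_S, such that the following holds. For every h > 0, every pair of points x₀, x₁ ∈ ℝ^d with dist(x₀, x₁) ≤ λ h, every Borel set S ⊆ closedBall(x₀, λ h) with μH^{d−1}(S) ≤ C_S · h^{d−1}, and every polynomial p of degree at most m in d variables, one has ∫_S ‖∇p‖² dμH^{d−1} ≤ C · h^{−1} · ∫_{B(x₁, c₀ h)} ‖∇p(x)‖² dx. -/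
open MeasureTheory Metric

theorem InnerProductSpace.Core.exists_norm_sq_le_inner {V F : Type*} [AddCommGroup V] [Module ℝ V]
    [FiniteDimensional ℝ V] [NormedAddCommGroup F] [NormedSpace ℝ F]
    (core : InnerProductSpace.Core ℝ V) (T : V →ₗ[ℝ] F) :
    ∃ C : ℝ, 0 < C ∧ ∀ v, ‖T v‖ ^ 2 ≤ C * core.inner v v := by
  let _ : NormedAddCommGroup V := core.toNormedAddCommGroup
  let _ : InnerProductSpace ℝ V := InnerProductSpace.ofCore core.toCore
  let T' : V →L[ℝ] F := LinearMap.toContinuousLinearMap T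
  refine ⟨‖T'‖ ^ 2 + 1, by positivity, fun v => ?_⟩
  have hv : core.inner v v = ‖v‖ ^ 2 := real_inner_self_eq_norm_sq v
  calc ‖T v‖ ^ 2 ≤ (‖T'‖ * ‖v‖) ^ 2 := by gcongr; exact T'.le_opNorm v
    _ ≤ (‖T'‖ ^ 2 + 1) * core.inner v v := by rw [hv]; nlinarith [sq_nonneg ‖v‖]

namespace MvPolynomial

variable {σ : Type*}

theorem totalDegree_pderiv_le {R : Type*} [CommSemiring R] (i : σ) (p : MvPolynomial σ R) :
    (pderiv i p).totalDegree ≤ p.totalDegree := by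
  conv_lhs => rw [p.as_sum, map_sum]
  refine totalDegree_finsetSum_le fun s hs => ?_
  rw [pderiv_monomial]
  refine (totalDegree_monomial_le _ _).trans (le_trans ?_ (le_totalDegree hs))
  change Finsupp.degree _ ≤ Finsupp.degree _
  exact Finsupp.degree_mono tsub_le_self

theorem totalDegree_aeval_le_of_totalDegree_le_one {τ R : Type*} [CommSemiring R]
    {f : σ → MvPolynomial τ R} (hf : ∀ i, (f i).totalDegree ≤ 1) (p : MvPolynomial σ R) :
    (aeval f p).totalDegree ≤ p.totalDegree := by
  rw [aeval_def, eval₂_eq]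
  refine totalDegree_finsetSum_le fun s hs => ?_
  refine (totalDegree_mul _ _).trans (le_trans ?_ (le_totalDegree hs))
  rw [algebraMap_eq, totalDegree_C, zero_add]
  refine (totalDegree_finsetProd _ _).trans (Finset.sum_le_sum fun i _ => ?_)
  exact (totalDegree_pow _ _).trans ((Nat.mul_le_mul_left _ (hf i)).trans (mul_one _).le)

theorem continuous_eval_euclideanSpace_s4 (p : MvPolynomial σ ℝ) :
    Continuous fun y : EuclideanSpace ℝ σ => eval (fun i => y i) p :=
  p.continuous_eval.comp (PiLp.continuous_ofLp 2 _)

variable [Fintype σ]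

theorem hasFDerivAt_eval (p : MvPolynomial σ ℝ) (x : EuclideanSpace ℝ σ) :
    HasFDerivAt (fun y : EuclideanSpace ℝ σ => eval (fun i => y i) p)
      (innerSL ℝ (WithLp.toLp 2 fun i => eval (fun j => x j) (pderiv i p))) x := by
  classical
  induction p using MvPolynomial.induction_on with
  | C a =>
    simp only [eval_C]
    refine (hasFDerivAt_const a x).congr_fderiv (ContinuousLinearMap.ext fun v => ?_)
    simp [PiLp.inner_apply]
  | add p q hp hq =>
    simp only [map_add]
    refine (hp.add hq).congr_fderiv (ContinuousLinearMap.ext fun v => ?_)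
    simp [PiLp.inner_apply, mul_add, Finset.sum_add_distrib]
  | mul_X p i hp =>
    simp only [map_mul, eval_X]
    have hX : HasFDerivAt (fun y : EuclideanSpace ℝ σ => y i)
        (EuclideanSpace.proj i : EuclideanSpace ℝ σ →L[ℝ] ℝ) x :=
      (EuclideanSpace.proj i : EuclideanSpace ℝ σ →L[ℝ] ℝ).hasFDerivAt
    refine (hp.mul hX).congr_fderiv (ContinuousLinearMap.ext fun v => ?_)
    simp [PiLp.inner_apply, pderiv_X, Pi.single_apply, mul_add, Finset.sum_add_distrib,
      Finset.mul_sum, apply_ite]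
    grind

theorem norm_fderiv_eval_sq (p : MvPolynomial σ ℝ) (x : EuclideanSpace ℝ σ) :
    ‖fderiv ℝ (fun y : EuclideanSpace ℝ σ => eval (fun i => y i) p) x‖ ^ 2 =
      ∑ i, eval (fun j => x j) (pderiv i p) ^ 2 := by
  rw [(p.hasFDerivAt_eval x).fderiv, innerSL_apply_norm, EuclideanSpace.real_norm_sq_eq]

theorem eq_zero_of_eqOn_isOpen {p : MvPolynomial σ ℝ} {U : Set (EuclideanSpace ℝ σ)}
    (hU : IsOpen U) (hne : U.Nonempty) (h : ∀ y ∈ U, eval (fun i => y i) p = 0) : p = 0 := by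
  obtain ⟨y, hy⟩ := hne
  have hV : IsOpen ((WithLp.toLp 2 : (σ → ℝ) → EuclideanSpace ℝ σ) ⁻¹' U) :=
    hU.preimage (PiLp.continuous_toLp 2 _)
  obtain ⟨ε, hε, hball⟩ := Metric.isOpen_iff.mp hV (WithLp.ofLp y) hy
  refine funext_set (fun i => Metric.ball (y i) ε) (fun i => ?_) fun x hx => ?_
  · exact infinite_of_mem_nhds (y i) (Metric.ball_mem_nhds _ hε)
  · rw [map_zero]
    refine h (WithLp.toLp 2 x) (hball ?_)
    rwa [ball_pi _ hε]

theorem exists_eval_sq_le_integral_ball (m : ℕ) {r : ℝ} (hr : 0 < r) (R : ℝ) :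
    ∃ C : ℝ, 0 < C ∧ ∀ q : MvPolynomial σ ℝ, q.totalDegree ≤ m →
      ∀ y ∈ closedBall (0 : EuclideanSpace ℝ σ) R,
        eval (fun i => y i) q ^ 2 ≤
          C * ∫ z in ball (0 : EuclideanSpace ℝ σ) r, eval (fun i => z i) q ^ 2 := by
  have hint {f : EuclideanSpace ℝ σ → ℝ} (hf : Continuous f) : IntegrableOn f (ball 0 r) :=
    (hf.continuousOn.integrableOn_compact (isCompact_closedBall 0 r)).mono_set
      ball_subset_closedBall
  let W := restrictTotalDegree σ ℝ m
  have hc (p : W) : Continuous fun y : EuclideanSpace ℝ σ => eval (fun i => y i) p.1 :=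
    p.1.continuous_eval_euclideanSpace_s4
  let core : InnerProductSpace.Core ℝ W :=
    { inner := fun p q => ∫ z in ball (0 : EuclideanSpace ℝ σ) r,
        eval (fun i => z i) p.1 * eval (fun i => z i) q.1
      conj_inner_symm := fun p q => by simp [mul_comm]
      re_inner_nonneg := fun p => integral_nonneg fun z => mul_self_nonneg _
      add_left := fun p q s => by
        simp only [Submodule.coe_add, map_add, add_mul]
        exact integral_add (hint ((hc p).mul (hc s))) (hint ((hc q).mul (hc s)))
      smul_left := fun p q a => by
        simp [smul_eval, mul_assoc, integral_const_mul]
      definite := fun p hp => by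
        have h0 := (setIntegral_eq_zero_iff_of_nonneg_ae
          (Filter.Eventually.of_forall fun z => mul_self_nonneg _)
          (hint ((hc p).mul (hc p)))).mp hp
        have h1 := Measure.eqOn_open_of_ae_eq h0 isOpen_ball
          ((hc p).mul (hc p)).continuousOn continuousOn_const
        exact Subtype.ext (eq_zero_of_eqOn_isOpen isOpen_ball ⟨0, mem_ball_self hr⟩
          fun y hy => mul_self_eq_zero.mp (h1 hy)) }
  have : CompactSpace (closedBall (0 : EuclideanSpace ℝ σ) R) :=
    isCompact_iff_compactSpace.mp (isCompact_closedBall 0 R)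
  let T : W →ₗ[ℝ] C(closedBall (0 : EuclideanSpace ℝ σ) R, ℝ) :=
    { toFun := fun p => ⟨fun y => eval (fun i => y.1 i) p.1, (hc p).comp continuous_subtype_val⟩
      map_add' := fun p q => by ext; simp
      map_smul' := fun a p => by ext; simp [smul_eval] }
  obtain ⟨C, hC, H⟩ := core.exists_norm_sq_le_inner T
  refine ⟨C, hC, fun q hq y hy => ?_⟩
  let p : W := ⟨q, (mem_restrictTotalDegree _ _ _).mpr hq⟩
  have hp : core.inner p p =
      ∫ z in ball (0 : EuclideanSpace ℝ σ) r, eval (fun i => z i) q ^ 2 := by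
    simp only [sq]
    rfl
  have hy : ‖eval (fun i => y i) q‖ ≤ ‖T p‖ := (T p).norm_coe_le_norm ⟨y, hy⟩
  calc eval (fun i => y i) q ^ 2 = ‖eval (fun i => y i) q‖ ^ 2 := (sq_abs _).symm
    _ ≤ ‖T p‖ ^ 2 := by gcongr
    _ ≤ _ := hp ▸ H p

theorem setIntegral_ball_comp_add_smul (f : EuclideanSpace ℝ σ → ℝ) (x : EuclideanSpace ℝ σ)
    (r : ℝ) {h : ℝ} (hh : 0 < h) :
    ∫ z in ball (0 : EuclideanSpace ℝ σ) r, f (x + h • z) =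
      (h ^ Fintype.card σ)⁻¹ * ∫ z in ball x (r * h), f z := by
  have htrans := (measurePreserving_add_left volume x).setIntegral_preimage_emb
    (measurableEmbedding_addLeft x) f (ball x (r * h))
  rw [preimage_add_ball, sub_self] at htrans
  rw [Measure.setIntegral_comp_smul_of_pos volume (fun z => f (x + z)) _ hh,
    finrank_euclideanSpace, _root_.smul_ball hh.ne', smul_zero, smul_eq_mul,
    Real.norm_of_nonneg hh.le, mul_comm h r, htrans]

theorem exists_eval_sq_le_setIntegral_ball (m : ℕ) {c : ℝ} (hc : 0 < c) (R : ℝ) :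
    ∃ C : ℝ, 0 < C ∧ ∀ h : ℝ, 0 < h → ∀ q : MvPolynomial σ ℝ, q.totalDegree ≤ m →
      ∀ x₁, ∀ x ∈ closedBall (x₁ : EuclideanSpace ℝ σ) (R * h),
        eval (fun i => x i) q ^ 2 ≤
          C * ((h ^ Fintype.card σ)⁻¹ * ∫ z in ball x₁ (c * h), eval (fun i => z i) q ^ 2) := by
  obtain ⟨C, hC, H⟩ := exists_eval_sq_le_integral_ball (σ := σ) m hc R
  refine ⟨C, hC, fun h hh q hq x₁ x hx => ?_⟩
  let g : σ → MvPolynomial σ ℝ := fun i => MvPolynomial.C (x₁ i) + MvPolynomial.C h * X i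
  have hg i : (g i).totalDegree ≤ 1 := by
    refine (totalDegree_add _ _).trans (max_le (by simp) ((totalDegree_mul _ _).trans ?_))
    simp
  have heval (z : EuclideanSpace ℝ σ) :
      eval (fun i => z i) (aeval g q) = eval (fun i => (x₁ + h • z) i) q := by
    rw [← coe_aeval_eq_eval, ← coe_aeval_eq_eval]
    change aeval _ (aeval g q) = aeval _ q
    rw [← bind₁, aeval_bind₁]
    congr 2
    ext i
    simp [g]
  have hy : h⁻¹ • (x - x₁) ∈ closedBall (0 : EuclideanSpace ℝ σ) R := by
    rw [mem_closedBall_zero_iff, norm_smul, norm_inv, Real.norm_of_nonneg hh.le,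
      inv_mul_le_iff₀ hh, mul_comm, ← dist_eq_norm]
    exact hx
  have key := H _ ((totalDegree_aeval_le_of_totalDegree_le_one hg q).trans hq) _ hy
  simp only [heval] at key
  rw [smul_inv_smul₀ hh.ne', add_sub_cancel,
    setIntegral_ball_comp_add_smul (fun z => eval (fun i => z i) q ^ 2) x₁ c hh] at key
  exact key

theorem exists_norm_fderiv_eval_sq_le_setIntegral_ball (m : ℕ) {c : ℝ} (hc : 0 < c) (R : ℝ) :
    ∃ C : ℝ, 0 < C ∧ ∀ h : ℝ, 0 < h → ∀ p : MvPolynomial σ ℝ, p.totalDegree ≤ m →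
      ∀ x₁, ∀ x ∈ closedBall (x₁ : EuclideanSpace ℝ σ) (R * h),
        ‖fderiv ℝ (fun y : EuclideanSpace ℝ σ => eval (fun i => y i) p) x‖ ^ 2 ≤
          C * ((h ^ Fintype.card σ)⁻¹ * ∫ z in ball x₁ (c * h),
            ‖fderiv ℝ (fun y : EuclideanSpace ℝ σ => eval (fun i => y i) p) z‖ ^ 2) := by
  obtain ⟨C, hC, H⟩ := exists_eval_sq_le_setIntegral_ball (σ := σ) m hc R
  refine ⟨C, hC, fun h hh p hp x₁ x hx => ?_⟩
  simp only [norm_fderiv_eval_sq]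
  rw [integral_finsetSum _ fun i _ => ?_, Finset.mul_sum, Finset.mul_sum]
  · exact Finset.sum_le_sum fun i _ =>
      H h hh _ ((totalDegree_pderiv_le i p).trans hp) x₁ x hx
  · exact (((pderiv i p).continuous_eval_euclideanSpace_s4.pow 2).continuousOn.integrableOn_compact
      (isCompact_closedBall x₁ (c * h))).mono_set ball_subset_closedBall

end MvPolynomial

/-- Discrete trace estimate for gradients of polynomials on lower-dimensional
sets (Lemma 3.1, inequality (3.6), α = 1, abstract form). -/
theorem polynomial_gradient_discrete_trace_estimate
    (d m : ℕ) (hd : 1 ≤ d) (lam c₀ CS : ℝ)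
    (hlam : 1 ≤ lam) (hc₀ : 0 < c₀) (hc₀' : c₀ ≤ 1) (hCS : 0 < CS) :
    ∃ C : ℝ, 0 < C ∧
      ∀ (h : ℝ), 0 < h →
        ∀ (x₀ x₁ : EuclideanSpace ℝ (Fin d)), dist x₀ x₁ ≤ lam * h →
          ∀ S : Set (EuclideanSpace ℝ (Fin d)), MeasurableSet S →
            S ⊆ closedBall x₀ (lam * h) →
            μH[(d : ℝ) - 1] S ≤ ENNReal.ofReal (CS * h ^ (d - 1)) →
            ∀ p : MvPolynomial (Fin d) ℝ, p.totalDegree ≤ m →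
              ∫ x in S,
                  ‖fderiv ℝ (fun y : EuclideanSpace ℝ (Fin d) =>
                      MvPolynomial.eval (fun i => y i) p) x‖ ^ 2
                  ∂(μH[(d : ℝ) - 1]) ≤
                C * h⁻¹ * ∫ x in ball x₁ (c₀ * h),
                  ‖fderiv ℝ (fun y : EuclideanSpace ℝ (Fin d) =>
                      MvPolynomial.eval (fun i => y i) p) x‖ ^ 2 := by
  obtain ⟨C, hC, H⟩ :=
    MvPolynomial.exists_norm_fderiv_eval_sq_le_setIntegral_ball (σ := Fin d) m hc₀ (2 * lam)
  refine ⟨C * CS, by positivity, fun h hh x₀ x₁ hdist S _ hS hμ p hp => ?_⟩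
  set f := fun y : EuclideanSpace ℝ (Fin d) => MvPolynomial.eval (fun i => y i) p
  set I := ∫ x in ball x₁ (c₀ * h), ‖fderiv ℝ f x‖ ^ 2
  have hI : 0 ≤ I := integral_nonneg fun _ => by positivity
  have hbound : ∀ x ∈ S, ‖‖fderiv ℝ f x‖ ^ 2‖ ≤ C * ((h ^ d)⁻¹ * I) := fun x hx => by
    rw [Real.norm_of_nonneg (by positivity)]
    have hx₁ : x ∈ closedBall x₁ (2 * lam * h) :=
      closedBall_subset_closedBall' (by linarith) (hS hx)
    simpa using H h hh p hp x₁ x hx₁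
  have hreal : (μH[(d : ℝ) - 1]).real S ≤ CS * h ^ (d - 1) :=
    ENNReal.toReal_le_of_le_ofReal (by positivity) hμ
  calc ∫ x in S, ‖fderiv ℝ f x‖ ^ 2 ∂(μH[(d : ℝ) - 1])
      ≤ C * ((h ^ d)⁻¹ * I) * (μH[(d : ℝ) - 1]).real S :=
        (le_abs_self _).trans
          (norm_setIntegral_le_of_norm_le_const (hμ.trans_lt ENNReal.ofReal_lt_top) hbound)
    _ ≤ C * ((h ^ d)⁻¹ * I) * (CS * h ^ (d - 1)) := by gcongr
    _ = C * CS * h⁻¹ * I := by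
        obtain ⟨n, rfl⟩ := Nat.exists_eq_add_of_le' hd
        rw [Nat.add_sub_cancel]
        field_simp
        ring
end
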